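/- arXiv:2301.09818 — 3 statements merged into one kernel-verified Lean document; each statement's English description precedes it below -/
import Mathlib

section
/- Let u₀ ∈ M and let {u_n} be the iterates of the H¹-scheme starting at u₀. Then there exist constants C_u, C_g, and C_α ≤ 1, depending only on Ω, d, β, V, and ‖u₀‖_{H^1_0(Ω)}, such that whenever the stepsizes satisfy 0 < α_min ≤ α_n ≤ α_max ≤ C_α for all n ≥ 0, the following hold for every n ≥ 0: (i) ‖u_n‖_{H^1_0(Ω)} ≤ C_u; (ii) ‖∇^R_{H¹}E(u_n)‖_{H^1_0(Ω)} ≤ ‖∇_{H¹}E(u_n)‖_{H^1_0(Ω)} ≤ C_g; (iii) E(u_n) − E(u_{n+1}) ≥ (α_min/2)·‖∇^R_{H¹}E(u_n)‖²_{H^1_0(Ω)}. -/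
open scoped RealInnerProductSpace
open Filter Topology

/-- Abstract setting for the Gross–Pitaevskii eigenvalue problem on a bounded
Lipschitz domain `Ω ⊆ ℝᵈ` (`d ∈ {1,2,3}`) with potential `0 ≤ V ≤ Vmax` in
`L^∞(Ω)` and interaction parameter `β ≥ 0`.

The Hilbert space `H` plays the role of `H¹₀(Ω)` equipped with the inner product
`(z,w)_{H¹₀} = (∇z,∇w)_{L²}`; `P z w` is the `L²(Ω)` inner product `∫ z w`,
`Vf z w = ∫ V z w`, and `Q4 a b c d = ∫ a b c d` (defined on `H` thanks to the
Sobolev embedding `H¹₀ ↪ L⁴` valid for `d ≤ 3`).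

`C₁`, `C₂`, `C₃` are, respectively, the constants of the embedding
`‖u‖_{L⁴} ≤ C₁ ‖u‖_{H¹₀}`, of the embedding `‖·‖_{H⁻¹} ≤ C₂ ‖·‖_{L^{4/3}}`,
and of the Poincaré inequality `‖u‖_{L²} ≤ C₃ ‖u‖_{H¹₀}`.

`G`, `GV`, `Gc` are, respectively, `G_{H¹}`, `u ↦ G_{H¹}(V u)` and
`u ↦ G_{H¹}(|u|² u)`, characterized by their defining Riesz identities
(`Gc_bound` encodes `‖G_{H¹}(|u|²u)‖_{H¹₀} ≤ ‖u³‖_{H⁻¹} ≤ C₂ ‖u³‖_{L^{4/3}}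
= C₂ ‖u‖_{L⁴}³`).  `G0`, `G0c` are the analogous Green operators for the
`a₀`-inner product `(z,w)_{a₀} = ∫ ∇z·∇w + V z w`, and `Gau u` is the Green
operator for the `a_u`-inner product
`(z,w)_{a_u} = ∫ ∇z·∇w + V z w + β|u|² z w`. -/
structure GPSetting (H : Type*) [NormedAddCommGroup H] [InnerProductSpace ℝ H] where
  /-- the `L²(Ω)` inner product `(z,w)_{L²} = ∫ z w` on `H = H¹₀(Ω)` -/
  P : H →ₗ[ℝ] H →ₗ[ℝ] ℝ
  P_symm : ∀ z w : H, P z w = P w z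
  P_nonneg : ∀ z : H, 0 ≤ P z z
  P_definite : ∀ z : H, P z z = 0 → z = 0
  /-- `Vmax`, the (essential) upper bound of the potential `V` -/
  Vmax : ℝ
  Vmax_nonneg : 0 ≤ Vmax
  /-- the bilinear form `Vf z w = ∫ V z w` -/
  Vf : H →ₗ[ℝ] H →ₗ[ℝ] ℝ
  Vf_symm : ∀ z w : H, Vf z w = Vf w z
  Vf_nonneg : ∀ z : H, 0 ≤ Vf z z
  Vf_le : ∀ z : H, Vf z z ≤ Vmax * P z z
  /-- the interaction parameter `β ≥ 0` -/
  β : ℝ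
  β_nonneg : 0 ≤ β
  /-- the quadrilinear form `Q4 a b c d = ∫ a b c d` -/
  Q4 : H →ₗ[ℝ] H →ₗ[ℝ] H →ₗ[ℝ] H →ₗ[ℝ] ℝ
  Q4_symm₁ : ∀ a b c d : H, Q4 a b c d = Q4 b a c d
  Q4_symm₂ : ∀ a b c d : H, Q4 a b c d = Q4 a c b d
  Q4_symm₃ : ∀ a b c d : H, Q4 a b c d = Q4 a b d c
  Q4_sq_nonneg : ∀ z w : H, 0 ≤ Q4 z z w w
  /-- the constant of the Sobolev embedding `‖u‖_{L⁴} ≤ C₁ ‖u‖_{H¹₀}` -/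
  C₁ : ℝ
  C₁_pos : 0 < C₁
  embed_L4 : ∀ u : H, Q4 u u u u ≤ C₁ ^ 4 * ‖u‖ ^ 4
  /-- the constant of the embedding `‖·‖_{H⁻¹} ≤ C₂ ‖·‖_{L^{4/3}}` -/
  C₂ : ℝ
  C₂_pos : 0 < C₂
  /-- the Poincaré constant: `‖u‖_{L²} ≤ C₃ ‖u‖_{H¹₀}` -/
  C₃ : ℝ
  C₃_pos : 0 < C₃
  poincare : ∀ u : H, P u u ≤ C₃ ^ 2 * ‖u‖ ^ 2
  /-- the Green operator `G_{H¹}`: `(z, G_{H¹} w)_{H¹₀} = (z,w)_{L²}` -/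
  G : H →ₗ[ℝ] H
  G_def : ∀ z w : H, ⟪z, G w⟫ = P z w
  /-- `GV w = G_{H¹}(V w)`: `(z, G_{H¹}(Vw))_{H¹₀} = ∫ V z w` -/
  GV : H →ₗ[ℝ] H
  GV_def : ∀ z w : H, ⟪z, GV w⟫ = Vf z w
  /-- `Gc w = G_{H¹}(|w|² w)`: `(z, G_{H¹}(w³))_{H¹₀} = ∫ z w³` -/
  Gc : H → H
  Gc_def : ∀ z w : H, ⟪z, Gc w⟫ = Q4 z w w w
  Gc_bound : ∀ w : H, ‖Gc w‖ ≤ C₂ * (Q4 w w w w) ^ ((3 : ℝ) / 4)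
  /-- the Green operator `G_{a₀}`: `(z, G_{a₀} w)_{a₀} = (z,w)_{L²}` -/
  G0 : H →ₗ[ℝ] H
  G0_def : ∀ z w : H, ⟪z, G0 w⟫ + Vf z (G0 w) = P z w
  /-- `G0c w = G_{a₀}(|w|² w)` -/
  G0c : H → H
  G0c_def : ∀ z w : H, ⟪z, G0c w⟫ + Vf z (G0c w) = Q4 z w w w
  /-- the Green operator `G_{a_u}`: `(z, G_{a_u} w)_{a_u} = (z,w)_{L²}` -/
  Gau : H → H → H
  Gau_def : ∀ u z w : H,
    ⟪z, Gau u w⟫ + Vf z (Gau u w) + β * Q4 u u z (Gau u w) = P z w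

namespace GPSetting

variable {H : Type*} [NormedAddCommGroup H] [InnerProductSpace ℝ H] (S : GPSetting H)

/-- the `L²(Ω)` norm -/
noncomputable def l2norm (u : H) : ℝ := Real.sqrt (S.P u u)

/-- the `L⁴(Ω)` norm -/
noncomputable def l4norm (u : H) : ℝ := (S.Q4 u u u u) ^ ((1 : ℝ) / 4)

/-- the `H⁻¹(Ω)` (dual) norm of an element of `H¹₀(Ω)` -/
noncomputable def HnegNorm (u : H) : ℝ := ⨆ z : {z : H // ‖z‖ ≤ 1}, S.P z.1 u

/-- the manifold `M = {u ∈ H¹₀(Ω) : ‖u‖_{L²} = 1}` -/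
def Msphere : Set H := {u : H | S.P u u = 1}

/-- the Gross–Pitaevskii energy
`E(u) = ∫ (1/2)|∇u|² + (1/2)V|u|² + (β/4)|u|⁴` -/
noncomputable def energy (u : H) : ℝ :=
  (1 / 2) * ‖u‖ ^ 2 + (1 / 2) * S.Vf u u + (S.β / 4) * S.Q4 u u u u

/-- the retraction `R(u) = u / ‖u‖_{L²}` -/
noncomputable def retract (u : H) : H := (S.l2norm u)⁻¹ • u

/-- the `H¹`-gradient `∇_{H¹}E(u) = u + G_{H¹}(Vu + β|u|²u)` -/
noncomputable def gradH1 (u : H) : H := u + S.GV u + S.β • S.Gc u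

/-- the Riemannian `H¹`-gradient
`∇^R_{H¹}E(u) = ∇_{H¹}E(u) − ((∇_{H¹}E(u),u)_{L²}/‖G_{H¹}u‖²_{H¹₀}) G_{H¹}u` -/
noncomputable def gradRH1 (u : H) : H :=
  S.gradH1 u - (S.P (S.gradH1 u) u / ‖S.G u‖ ^ 2) • S.G u

/-- the `a₀`-inner product `(z,w)_{a₀} = ∫ ∇z·∇w + Vzw` -/
noncomputable def a0inner (z w : H) : ℝ := ⟪z, w⟫ + S.Vf z w

/-- the `a₀`-norm -/
noncomputable def a0norm (z : H) : ℝ := Real.sqrt (S.a0inner z z)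

/-- the `a₀`-gradient `∇_{a₀}E(u) = u + β G_{a₀}(|u|²u)` -/
noncomputable def gradA0 (u : H) : H := u + S.β • S.G0c u

/-- the Riemannian `a₀`-gradient
`∇^R_{a₀}E(u) = ∇_{a₀}E(u) − ((∇_{a₀}E(u),u)_{L²}/‖G_{a₀}u‖²_{a₀}) G_{a₀}u` -/
noncomputable def gradRA0 (u : H) : H :=
  S.gradA0 u - (S.P (S.gradA0 u) u / (S.a0norm (S.G0 u)) ^ 2) • S.G0 u

/-- the `a_u`-inner product `(z,w)_{a_u} = ∫ ∇z·∇w + Vzw + β|u|²zw` -/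
noncomputable def auinner (u z w : H) : ℝ :=
  ⟪z, w⟫ + S.Vf z w + S.β * S.Q4 u u z w

/-- the `a_u`-norm -/
noncomputable def aunorm (u z : H) : ℝ := Real.sqrt (S.auinner u z z)

/-- the Riemannian `a_u`-gradient
`∇^R_{a_u}E(u) = u − G_{a_u}u / ‖G_{a_u}u‖²_{a_u}` -/
noncomputable def gradRAu (u : H) : H :=
  u - ((S.aunorm u (S.Gau u u)) ^ 2)⁻¹ • S.Gau u u

/-- `ustar` is the ground state: the minimizer of `E` over `M`. -/
def IsGroundState (ustar : H) : Prop :=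
  ustar ∈ S.Msphere ∧ ∀ u ∈ S.Msphere, S.energy ustar ≤ S.energy u

/-- `lam0` and `lam1` are the smallest and second smallest eigenvalues of the
linearized problem `(−Δ + V + β|u*|²)u = λu` at the ground state `u*` (whose
bilinear form is the `a_{u*}`-inner product): `u*` is an eigenfunction for
`lam0`, `lam0` is a lower bound for the Rayleigh quotient, and `lam1` is a lower
bound for the Rayleigh quotient on the `L²`-orthogonal complement of `u*`. -/
def LinearizedEigs (ustar : H) (lam0 lam1 : ℝ) : Prop :=
  (∀ z : H, S.auinner ustar z ustar = lam0 * S.P z ustar) ∧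
  (∀ z : H, lam0 * S.P z z ≤ S.auinner ustar z z) ∧
  (∀ z : H, S.P z ustar = 0 → lam1 * S.P z z ≤ S.auinner ustar z z)

end GPSetting

namespace GPSetting

variable {H : Type*} [NormedAddCommGroup H] [InnerProductSpace ℝ H] (S : GPSetting H)

lemma Q4_add_smul (u d : H) (t : ℝ) :
    S.Q4 (u + t • d) (u + t • d) (u + t • d) (u + t • d) =
      S.Q4 u u u u + 4 * t * S.Q4 d u u u + 6 * t ^ 2 * S.Q4 u u d d
        + 4 * t ^ 3 * S.Q4 u d d d + t ^ 4 * S.Q4 d d d d := by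
  have h1 : S.Q4 u d u u = S.Q4 d u u u := S.Q4_symm₁ _ _ _ _
  have h2 : S.Q4 u u d u = S.Q4 d u u u := by rw [S.Q4_symm₂, h1]
  have h3 : S.Q4 u u u d = S.Q4 d u u u := by rw [S.Q4_symm₃, h2]
  have h4 : S.Q4 u d u d = S.Q4 u u d d := S.Q4_symm₂ _ _ _ _
  have h5 : S.Q4 u d d u = S.Q4 u u d d := by rw [S.Q4_symm₃, h4]
  have h6 : S.Q4 d u u d = S.Q4 u u d d := by rw [S.Q4_symm₁, h4]
  have h7 : S.Q4 d u d u = S.Q4 u u d d := by rw [S.Q4_symm₁, h5]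
  have h8 : S.Q4 d d u u = S.Q4 u u d d := by rw [S.Q4_symm₂, h7]
  have h9 : S.Q4 d u d d = S.Q4 u d d d := S.Q4_symm₁ _ _ _ _
  have h10 : S.Q4 d d u d = S.Q4 u d d d := by rw [S.Q4_symm₂, h9]
  have h11 : S.Q4 d d d u = S.Q4 u d d d := by rw [S.Q4_symm₃, h10]
  simp only [map_add, map_smul, LinearMap.add_apply, LinearMap.smul_apply, smul_eq_mul,
    h1, h2, h3, h4, h5, h6, h7, h8, h9, h10, h11]
  ring

lemma Q4_sq_sq_le (u d : H) : S.Q4 u u d d ≤ 3 * S.C₁ ^ 4 * ‖u‖ ^ 2 * ‖d‖ ^ 2 := by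
  by_cases hu : u = 0
  · simp [hu]
  by_cases hd : d = 0
  · simp [hd]
  have ha : 0 < ‖u‖ := norm_pos_iff.2 hu
  have hb : 0 < ‖d‖ := norm_pos_iff.2 hd
  have hx : ‖‖d‖ • u‖ = ‖u‖ * ‖d‖ := by rw [norm_smul, norm_norm, mul_comm]
  have hy : ‖‖u‖ • d‖ = ‖u‖ * ‖d‖ := by rw [norm_smul, norm_norm]
  have bound : ∀ z : H, ‖z‖ ≤ 2 * (‖u‖ * ‖d‖) →
      S.Q4 z z z z ≤ S.C₁ ^ 4 * (2 * (‖u‖ * ‖d‖)) ^ 4 := fun z hz =>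
    (S.embed_L4 z).trans (by have := S.C₁_pos; gcongr)
  have e1 := S.Q4_add_smul (‖d‖ • u) (‖u‖ • d) 1
  have e2 := S.Q4_add_smul (‖d‖ • u) (‖u‖ • d) (-1)
  have b1 := bound (‖d‖ • u + (1 : ℝ) • ‖u‖ • d) <| (norm_add_le _ _).trans (by
    rw [one_smul, hx, hy]; linarith)
  have b2 := bound (‖d‖ • u + (-1 : ℝ) • ‖u‖ • d) <| (norm_add_le _ _).trans (by
    rw [neg_one_smul, norm_neg, hx, hy]; linarith)
  have n1 := S.Q4_sq_nonneg (‖d‖ • u) (‖d‖ • u)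
  have n2 := S.Q4_sq_nonneg (‖u‖ • d) (‖u‖ • d)
  have e3 : S.Q4 (‖d‖ • u) (‖d‖ • u) (‖u‖ • d) (‖u‖ • d) =
      ‖u‖ ^ 2 * ‖d‖ ^ 2 * S.Q4 u u d d := by
    simp only [map_smul, LinearMap.smul_apply, smul_eq_mul]; ring
  have hc : 0 ≤ S.C₁ ^ 4 * (‖u‖ * ‖d‖) ^ 4 := by positivity
  have key : ‖u‖ ^ 2 * ‖d‖ ^ 2 * S.Q4 u u d d ≤
      ‖u‖ ^ 2 * ‖d‖ ^ 2 * (3 * S.C₁ ^ 4 * ‖u‖ ^ 2 * ‖d‖ ^ 2) := by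
    rw [← e3]; nlinarith
  exact le_of_mul_le_mul_left key (by positivity)

lemma Vf_le_norm_sq (z : H) : S.Vf z z ≤ S.Vmax * S.C₃ ^ 2 * ‖z‖ ^ 2 := by
  rw [mul_assoc]
  exact (S.Vf_le z).trans (mul_le_mul_of_nonneg_left (S.poincare z) S.Vmax_nonneg)

lemma norm_GV_le (u : H) : ‖S.GV u‖ ≤ S.Vmax * S.C₃ ^ 2 * ‖u‖ := by
  have hK : 0 ≤ S.Vmax * S.C₃ ^ 2 := mul_nonneg S.Vmax_nonneg (sq_nonneg _)
  by_cases hx : S.GV u = 0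
  · rw [hx, norm_zero]; positivity
  have hpos : 0 < ‖S.GV u‖ := norm_pos_iff.2 hx
  have hcs : S.Vf (S.GV u) u ^ 2 ≤ S.Vf (S.GV u) (S.GV u) * S.Vf u u :=
    LinearMap.BilinForm.apply_sq_le_of_symm S.Vf S.Vf_nonneg ⟨fun z w => S.Vf_symm z w⟩ _ _
  rw [← S.GV_def, real_inner_self_eq_norm_sq] at hcs
  have h2 : S.Vf (S.GV u) (S.GV u) * S.Vf u u ≤
      (S.Vmax * S.C₃ ^ 2 * ‖S.GV u‖ ^ 2) * (S.Vmax * S.C₃ ^ 2 * ‖u‖ ^ 2) :=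
    mul_le_mul (S.Vf_le_norm_sq _) (S.Vf_le_norm_sq _) (S.Vf_nonneg _) (by positivity)
  have h3 : ‖S.GV u‖ ^ 2 * ‖S.GV u‖ ^ 2 ≤ ‖S.GV u‖ ^ 2 * (S.Vmax * S.C₃ ^ 2 * ‖u‖) ^ 2 := by
    linarith
  exact le_of_sq_le_sq (le_of_mul_le_mul_left h3 (by positivity)) (by positivity)

lemma norm_Gc_le (u : H) : ‖S.Gc u‖ ≤ S.C₂ * S.C₁ ^ 3 * ‖u‖ ^ 3 := by
  have hC := S.C₁_pos
  have h : S.Q4 u u u u ^ ((3 : ℝ) / 4) ≤ (S.C₁ * ‖u‖) ^ 3 := by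
    have h1 := Real.rpow_le_rpow (S.Q4_sq_nonneg u u) (S.embed_L4 u)
      (by norm_num : (0 : ℝ) ≤ 3 / 4)
    refine h1.trans_eq ?_
    rw [← mul_pow, ← Real.rpow_natCast, ← Real.rpow_mul (by positivity), ← Real.rpow_natCast]
    norm_num
  calc ‖S.Gc u‖ ≤ S.C₂ * S.Q4 u u u u ^ ((3 : ℝ) / 4) := S.Gc_bound u
    _ ≤ S.C₂ * (S.C₁ * ‖u‖) ^ 3 := mul_le_mul_of_nonneg_left h S.C₂_pos.le
    _ = _ := by ring

lemma norm_gradH1_le (u : H) :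
    ‖S.gradH1 u‖ ≤ ‖u‖ + S.Vmax * S.C₃ ^ 2 * ‖u‖ + S.β * (S.C₂ * S.C₁ ^ 3 * ‖u‖ ^ 3) := by
  refine (norm_add₃_le).trans ?_
  rw [norm_smul, Real.norm_of_nonneg S.β_nonneg]
  exact add_le_add (add_le_add le_rfl (S.norm_GV_le u))
    (mul_le_mul_of_nonneg_left (S.norm_Gc_le u) S.β_nonneg)

lemma inner_gradH1 (z u : H) :
    ⟪z, S.gradH1 u⟫ = ⟪z, u⟫ + S.Vf z u + S.β * S.Q4 z u u u := by
  rw [gradH1, inner_add_right, inner_add_right, inner_smul_right, S.GV_def, S.Gc_def]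

lemma inner_gradRH1_G (u : H) : ⟪S.gradRH1 u, S.G u⟫ = 0 := by
  by_cases h : S.G u = 0
  · simp [h]
  · have : ‖S.G u‖ ≠ 0 := norm_ne_zero_iff.2 h
    rw [gradRH1, inner_sub_left, inner_smul_left, S.G_def, real_inner_self_eq_norm_sq]
    simp only [conj_trivial]
    field_simp
    ring

lemma P_gradRH1 (u : H) : S.P (S.gradRH1 u) u = 0 := by
  rw [← S.G_def, S.inner_gradRH1_G]

lemma inner_gradRH1_gradH1 (u : H) : ⟪S.gradRH1 u, S.gradH1 u⟫ = ‖S.gradRH1 u‖ ^ 2 := by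
  have h : S.gradH1 u = S.gradRH1 u + (S.P (S.gradH1 u) u / ‖S.G u‖ ^ 2) • S.G u := by
    rw [gradRH1, sub_add_cancel]
  conv_lhs => rw [h]
  rw [inner_add_right, inner_smul_right, S.inner_gradRH1_G, mul_zero, add_zero,
    real_inner_self_eq_norm_sq]

lemma norm_gradRH1_le (u : H) : ‖S.gradRH1 u‖ ≤ ‖S.gradH1 u‖ := by
  have h1 := real_inner_le_norm (S.gradRH1 u) (S.gradH1 u)
  rw [S.inner_gradRH1_gradH1, sq] at h1
  by_contra! hlt
  nlinarith [norm_nonneg (S.gradH1 u)]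

lemma P_sub_smul_gradRH1 {u : H} (hu : u ∈ S.Msphere) (a : ℝ) :
    1 ≤ S.P (u - a • S.gradRH1 u) (u - a • S.gradRH1 u) := by
  have hu' : S.P u u = 1 := hu
  have h := S.P_symm u (S.gradRH1 u)
  simp only [map_sub, map_smul, LinearMap.sub_apply, LinearMap.smul_apply, smul_eq_mul, h,
    S.P_gradRH1, hu']
  nlinarith [mul_nonneg (sq_nonneg a) (S.P_nonneg (S.gradRH1 u))]

lemma retract_mem_Msphere {v : H} (hv : 1 ≤ S.P v v) : S.retract v ∈ S.Msphere := by
  have hs : Real.sqrt (S.P v v) ^ 2 = S.P v v := Real.sq_sqrt (by linarith)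
  change S.P (S.retract v) (S.retract v) = 1
  simp only [retract, l2norm, map_smul, LinearMap.smul_apply, smul_eq_mul]
  rw [← mul_assoc, ← sq, inv_pow, hs]
  exact inv_mul_cancel₀ (by linarith)

lemma energy_smul_le {s : ℝ} (hs0 : 0 ≤ s) (hs1 : s ≤ 1) (v : H) :
    S.energy (s • v) ≤ S.energy v := by
  have hβ := S.β_nonneg
  have h2 : s ^ 2 ≤ 1 := pow_le_one₀ hs0 hs1
  have h4 : s ^ 4 ≤ 1 := pow_le_one₀ hs0 hs1
  have key : S.energy (s • v) = (1 / 2) * (s ^ 2 * ‖v‖ ^ 2) + (1 / 2) * (s ^ 2 * S.Vf v v)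
      + (S.β / 4) * (s ^ 4 * S.Q4 v v v v) := by
    simp only [energy, norm_smul, Real.norm_eq_abs, mul_pow, sq_abs, map_smul,
      LinearMap.smul_apply, smul_eq_mul]
    ring
  rw [key, energy]
  gcongr
  · exact mul_le_of_le_one_left (sq_nonneg _) h2
  · exact mul_le_of_le_one_left (S.Vf_nonneg v) h2
  · exact mul_le_of_le_one_left (S.Q4_sq_nonneg v v) h4

lemma energy_retract_le {v : H} (hv : 1 ≤ S.P v v) : S.energy (S.retract v) ≤ S.energy v :=
  S.energy_smul_le (inv_nonneg.2 (Real.sqrt_nonneg _))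
    (inv_le_one_of_one_le₀ (Real.one_le_sqrt.2 hv)) v

lemma energy_sub_smul (u d : H) (a : ℝ) :
    S.energy (u - a • d) = S.energy u - a * ⟪d, S.gradH1 u⟫
      + a ^ 2 * (1 / 2 * ‖d‖ ^ 2 + 1 / 2 * S.Vf d d + 3 / 2 * S.β * S.Q4 u u d d)
      - a ^ 3 * S.β * S.Q4 u d d d + a ^ 4 * (S.β / 4) * S.Q4 d d d d := by
  have hQ := S.Q4_add_smul u d (-a)
  rw [neg_smul, ← sub_eq_add_neg] at hQ
  have hn : ‖u - a • d‖ ^ 2 = ‖u‖ ^ 2 - 2 * a * ⟪d, u⟫ + a ^ 2 * ‖d‖ ^ 2 := by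
    rw [norm_sub_sq_real, inner_smul_right, norm_smul, mul_pow, Real.norm_eq_abs, sq_abs,
      real_inner_comm]
    ring
  have hV : S.Vf (u - a • d) (u - a • d) =
      S.Vf u u - 2 * a * S.Vf d u + a ^ 2 * S.Vf d d := by
    have h := S.Vf_symm u d
    simp only [map_sub, map_smul, LinearMap.sub_apply, LinearMap.smul_apply, smul_eq_mul, h]
    ring
  rw [energy, hQ, hn, hV, energy, S.inner_gradH1]
  ring

/-- One gradient step decreases the energy once the stepsize is small relative to the local
curvature of the energy. -/
lemma energy_step {u : H} {a Cu Cg : ℝ} (hu : ‖u‖ ≤ Cu) (hg : ‖S.gradH1 u‖ ≤ Cg)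
    (ha0 : 0 ≤ a) (ha1 : a ≤ 1)
    (ha : a * (1 + S.Vmax * S.C₃ ^ 2 + 12 * S.β * S.C₁ ^ 4 * Cu ^ 2
      + 3 / 2 * S.β * S.C₁ ^ 4 * Cg ^ 2) ≤ 1) :
    S.energy (u - a • S.gradRH1 u) ≤ S.energy u - a / 2 * ‖S.gradRH1 u‖ ^ 2 := by
  have hβ := S.β_nonneg
  have hC := S.C₁_pos
  have hdg : ‖S.gradRH1 u‖ ≤ Cg := (S.norm_gradRH1_le u).trans hg
  rw [S.energy_sub_smul, S.inner_gradRH1_gradH1]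
  set d := S.gradRH1 u
  have hV := S.Vf_le_norm_sq d
  have hq2 : S.Q4 u u d d ≤ 3 * S.C₁ ^ 4 * Cu ^ 2 * ‖d‖ ^ 2 :=
    (S.Q4_sq_sq_le u d).trans (by gcongr)
  have hq4 : S.Q4 d d d d ≤ S.C₁ ^ 4 * Cg ^ 2 * ‖d‖ ^ 2 := by
    refine (S.embed_L4 d).trans ?_
    have h : ‖d‖ ^ 2 ≤ Cg ^ 2 := by gcongr
    calc S.C₁ ^ 4 * ‖d‖ ^ 4 = S.C₁ ^ 4 * ‖d‖ ^ 2 * ‖d‖ ^ 2 := by ring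
      _ ≤ _ := by gcongr
  have hq3 : -(2 * a * S.Q4 u d d d) ≤ S.Q4 u u d d + a ^ 2 * S.Q4 d d d d := by
    have h := S.Q4_sq_nonneg (u + a • d) d
    simp only [map_add, map_smul, LinearMap.add_apply, LinearMap.smul_apply, smul_eq_mul,
      S.Q4_symm₁ d u d d] at h
    linarith
  have hq4' : a ^ 2 * S.Q4 d d d d ≤ S.C₁ ^ 4 * Cg ^ 2 * ‖d‖ ^ 2 :=
    (mul_le_of_le_one_left (S.Q4_sq_nonneg d d) (pow_le_one₀ ha0 ha1)).trans hq4
  have m3 := mul_le_mul_of_nonneg_left hq3 (by positivity : 0 ≤ a ^ 2 * S.β / 2)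
  have m4 := mul_le_mul_of_nonneg_left hq4' (by positivity : 0 ≤ 3 / 4 * (a ^ 2 * S.β))
  have m2 := mul_le_mul_of_nonneg_left hq2 (by positivity : 0 ≤ 2 * (a ^ 2 * S.β))
  have mV := mul_le_mul_of_nonneg_left hV (by positivity : 0 ≤ a ^ 2 / 2)
  have mL := mul_le_mul_of_nonneg_left ha (by positivity : 0 ≤ a / 2 * ‖d‖ ^ 2)
  linarith

lemma norm_sq_le_energy (u : H) : ‖u‖ ^ 2 ≤ 2 * S.energy u := by
  have h := mul_nonneg S.β_nonneg (S.Q4_sq_nonneg u u)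
  have h' := S.Vf_nonneg u
  rw [energy]
  linarith

lemma energy_le (u : H) : S.energy u ≤ (1 / 2) * ‖u‖ ^ 2
    + (1 / 2) * (S.Vmax * S.C₃ ^ 2 * ‖u‖ ^ 2) + (S.β / 4) * (S.C₁ ^ 4 * ‖u‖ ^ 4) := by
  have hβ := S.β_nonneg
  rw [energy]
  gcongr
  · exact S.Vf_le_norm_sq u
  · exact S.embed_L4 u

end GPSetting

/-- **Energy decay for the `H¹`-scheme** (Theorem `thm:energy_decay_H1`).
Given the norm `r = ‖u₀‖_{H¹₀}` of the initial point, there exist constants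
`Cu`, `Cg`, `Cα ≤ 1` (depending only on `Ω, d, β, V` — i.e. on the setting `S` —
and on `r`) such that for any `u₀ ∈ M` with `‖u₀‖ = r` and any stepsizes
`0 < αmin ≤ αₙ ≤ αmax ≤ Cα`, the iterates `u_{n+1} = R(uₙ − αₙ ∇^R_{H¹}E(uₙ))`
satisfy, for every `n`:
(i) `‖uₙ‖_{H¹₀} ≤ Cu`;
(ii) `‖∇^R_{H¹}E(uₙ)‖_{H¹₀} ≤ ‖∇_{H¹}E(uₙ)‖_{H¹₀} ≤ Cg`;
(iii) `E(uₙ) − E(u_{n+1}) ≥ (αmin/2)‖∇^R_{H¹}E(uₙ)‖²_{H¹₀}`. -/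
theorem energy_decay_H1
    {H : Type*} [NormedAddCommGroup H] [InnerProductSpace ℝ H]
    (S : GPSetting H) (r : ℝ) :
    ∃ Cu Cg Cα : ℝ, 0 < Cα ∧ Cα ≤ 1 ∧
      ∀ u₀ : H, u₀ ∈ S.Msphere → ‖u₀‖ = r →
        ∀ (αmin αmax : ℝ) (α : ℕ → ℝ),
          0 < αmin → (∀ n : ℕ, αmin ≤ α n ∧ α n ≤ αmax) → αmax ≤ Cα →
          ∀ u : ℕ → H, u 0 = u₀ →
            (∀ n : ℕ, u (n + 1) = S.retract (u n - α n • S.gradRH1 (u n))) →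
            ∀ n : ℕ,
              ‖u n‖ ≤ Cu ∧
              ‖S.gradRH1 (u n)‖ ≤ ‖S.gradH1 (u n)‖ ∧
              ‖S.gradH1 (u n)‖ ≤ Cg ∧
              αmin / 2 * ‖S.gradRH1 (u n)‖ ^ 2 ≤
                S.energy (u n) - S.energy (u (n + 1)) := by
  obtain ⟨E0, hE0⟩ : ∃ E0 : ℝ, E0 = (1 / 2) * r ^ 2
    + (1 / 2) * (S.Vmax * S.C₃ ^ 2 * r ^ 2) + (S.β / 4) * (S.C₁ ^ 4 * r ^ 4) := ⟨_, rfl⟩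
  obtain ⟨Cu, hCu⟩ : ∃ Cu : ℝ, Cu = Real.sqrt (2 * E0) := ⟨_, rfl⟩
  obtain ⟨Cg, hCg⟩ : ∃ Cg : ℝ, Cg = Cu + S.Vmax * S.C₃ ^ 2 * Cu
    + S.β * (S.C₂ * S.C₁ ^ 3 * Cu ^ 3) := ⟨_, rfl⟩
  obtain ⟨L, hL⟩ : ∃ L : ℝ, L = 1 + S.Vmax * S.C₃ ^ 2 + 12 * S.β * S.C₁ ^ 4 * Cu ^ 2
      + 3 / 2 * S.β * S.C₁ ^ 4 * Cg ^ 2 := ⟨_, rfl⟩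
  have hβ := S.β_nonneg
  have hV := S.Vmax_nonneg
  have hC₁ := S.C₁_pos
  have hC₂ := S.C₂_pos
  have hL1 : 1 ≤ L := by
    have h1 : 0 ≤ S.Vmax * S.C₃ ^ 2 := by positivity
    have h2 : 0 ≤ 12 * S.β * S.C₁ ^ 4 * Cu ^ 2 := by positivity
    have h3 : 0 ≤ 3 / 2 * S.β * S.C₁ ^ 4 * Cg ^ 2 := by positivity
    linarith
  refine ⟨Cu, Cg, L⁻¹, by positivity, inv_le_one_of_one_le₀ hL1, ?_⟩
  intro u₀ hu₀ hr αmin αmax α hmin hα hmax u h0 hstep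
  have bounds : ∀ w : H, S.energy w ≤ E0 → ‖w‖ ≤ Cu ∧ ‖S.gradH1 w‖ ≤ Cg := by
    intro w hw
    have hwu : ‖w‖ ≤ Cu := by
      rw [hCu]
      exact Real.le_sqrt_of_sq_le ((S.norm_sq_le_energy w).trans (by linarith))
    refine ⟨hwu, (S.norm_gradH1_le w).trans ?_⟩
    rw [hCg]
    gcongr
  have decay : ∀ n, u n ∈ S.Msphere → S.energy (u n) ≤ E0 →
      αmin / 2 * ‖S.gradRH1 (u n)‖ ^ 2 ≤ S.energy (u n) - S.energy (u (n + 1)) := by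
    intro n hM hE
    have hαL : α n ≤ L⁻¹ := (hα n).2.trans hmax
    have hα0 : 0 ≤ α n := hmin.le.trans (hα n).1
    have hle : α n * L ≤ 1 :=
      (mul_le_mul_of_nonneg_right hαL (by linarith)).trans_eq (inv_mul_cancel₀ (by linarith))
    have h1 := S.energy_step (bounds _ hE).1 (bounds _ hE).2 hα0
      (hαL.trans (inv_le_one_of_one_le₀ hL1)) (hL ▸ hle)
    have h2 := S.energy_retract_le (S.P_sub_smul_gradRH1 hM (α n))
    rw [← hstep] at h2
    have h3 := mul_le_mul_of_nonneg_right (hα n).1 (sq_nonneg ‖S.gradRH1 (u n)‖)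
    linarith
  have inv : ∀ n, u n ∈ S.Msphere ∧ S.energy (u n) ≤ E0 := by
    intro n
    induction n with
    | zero =>
      rw [h0]
      refine ⟨hu₀, (S.energy_le u₀).trans_eq ?_⟩
      rw [hr, hE0]
    | succ n ih =>
      constructor
      · rw [hstep]
        exact S.retract_mem_Msphere (S.P_sub_smul_gradRH1 ih.1 _)
      · have h := decay n ih.1 ih.2
        have : 0 ≤ αmin / 2 * ‖S.gradRH1 (u n)‖ ^ 2 := by positivity
        linarith [ih.2]
  intro n
  obtain ⟨hM, hE⟩ := inv n
  exact ⟨(bounds _ hE).1, S.norm_gradRH1_le _, (bounds _ hE).2, decay n hM hE⟩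
end

section
/- Assume the hypotheses of the energy-decay theorem for the a₀-scheme and the eigengap assumption λ₁ > λ₀. There exists a constant L_g, depending only on Ω, d, β, V, u*, and ‖u₀‖_{H^1_0(Ω)}, such that if in addition the stepsizes satisfy α_n ≤ α_max with 1 + L_g²α_max² − α_max·min{1, (λ₁−λ₀)/(4λ₀)} < 1, then the sequence {u_n} generated by the a₀-scheme with initial condition u₀ sufficiently close to u* converges exponentially in H^1_0(Ω) to the ground state u*. -/
open scoped RealInnerProductSpace
open Filter Topology

namespace GPSetting
variable {H : Type*} [NormedAddCommGroup H] [InnerProductSpace ℝ H] (S : GPSetting H)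

/-- The `a₀`-inner product as a bilinear map. -/
noncomputable def a0form : H →ₗ[ℝ] H →ₗ[ℝ] ℝ := innerₗ H + S.Vf

theorem a0form_apply (z w : H) : S.a0form z w = ⟪z, w⟫ + S.Vf z w := rfl

theorem a0form_symm (z w : H) : S.a0form z w = S.a0form w z := by
  rw [a0form_apply, a0form_apply, real_inner_comm, S.Vf_symm]

theorem sq_norm_le_a0form (z : H) : ‖z‖ ^ 2 ≤ S.a0form z z := by
  rw [a0form_apply, real_inner_self_eq_norm_sq]
  linarith [S.Vf_nonneg z]

theorem a0form_nonneg (z : H) : 0 ≤ S.a0form z z :=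
  (sq_nonneg _).trans (S.sq_norm_le_a0form z)

theorem a0form_le (z : H) : S.a0form z z ≤ (1 + S.Vmax * S.C₃ ^ 2) * ‖z‖ ^ 2 := by
  rw [a0form_apply, real_inner_self_eq_norm_sq]
  linarith [S.Vf_le z, mul_le_mul_of_nonneg_left (S.poincare z) S.Vmax_nonneg]

theorem sq_apply_le_of_nonneg (B : H →ₗ[ℝ] H →ₗ[ℝ] ℝ) (hs : ∀ z w, B z w = B w z)
    (hB : ∀ z, 0 ≤ B z z) (z w : H) : B z w ^ 2 ≤ B z z * B w w := by
  have h := LinearMap.BilinForm.apply_mul_apply_le_of_forall_zero_le B hB z w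
  rw [hs w z] at h
  rw [sq]; exact h

theorem eq_of_a0form_eq {x y : H} (h : ∀ z, S.a0form z x = S.a0form z y) : x = y := by
  have h1 := S.sq_norm_le_a0form (x - y)
  rw [map_sub (S.a0form (x - y)), h, sub_self] at h1
  have h2 : ‖x - y‖ = 0 := by nlinarith [norm_nonneg (x - y)]
  exact sub_eq_zero.mp (norm_eq_zero.mp h2)

theorem abs_P_le (z w : H) : |S.P z w| ≤ S.C₃ ^ 2 * ‖z‖ * ‖w‖ := by
  refine abs_le_of_sq_le_sq ?_ (by positivity)
  calc S.P z w ^ 2 ≤ S.P z z * S.P w w := sq_apply_le_of_nonneg S.P S.P_symm S.P_nonneg z w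
    _ ≤ (S.C₃ ^ 2 * ‖z‖ ^ 2) * (S.C₃ ^ 2 * ‖w‖ ^ 2) :=
      mul_le_mul (S.poincare z) (S.poincare w) (S.P_nonneg w) (by positivity)
    _ = _ := by ring

theorem Q4_sub_apply (x y b c d : H) :
    S.Q4 (x - y) b c d = S.Q4 x b c d - S.Q4 y b c d := by
  have h : S.Q4 (x - y + y) b c d = S.Q4 (x - y) b c d + S.Q4 y b c d := by
    simp only [map_add, LinearMap.add_apply]
  rw [sub_add_cancel] at h
  linarith

theorem Q4_sq_le (z w : H) : S.Q4 z z w w ≤ 3 * S.C₁ ^ 4 * ‖z‖ ^ 2 * ‖w‖ ^ 2 := by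
  have key : ∀ x y : H, ∀ p : ℝ, ‖x‖ ≤ p → ‖y‖ ≤ p → S.Q4 x x y y ≤ 3 * S.C₁ ^ 4 * p ^ 4 := by
    intro x y p hx hy
    have e : S.Q4 (x + y) (x + y) (x + y) (x + y) + S.Q4 (x - y) (x - y) (x - y) (x - y)
        = 2 * S.Q4 x x x x + 12 * S.Q4 x x y y + 2 * S.Q4 y y y y := by
      simp only [map_add, map_sub, Q4_sub_apply, LinearMap.add_apply, LinearMap.sub_apply]
      have h1 : S.Q4 x y x y = S.Q4 x x y y := S.Q4_symm₂ _ _ _ _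
      have h2 : S.Q4 x y y x = S.Q4 x x y y := by rw [S.Q4_symm₃, h1]
      have h3 : S.Q4 y x x y = S.Q4 x x y y := by rw [S.Q4_symm₁, h1]
      have h4 : S.Q4 y x y x = S.Q4 x x y y := by rw [S.Q4_symm₁, h2]
      have h5 : S.Q4 y y x x = S.Q4 x x y y := by rw [S.Q4_symm₂, h4]
      rw [h1, h2, h3, h4, h5]
      ring
    have hp : 0 ≤ p := (norm_nonneg x).trans hx
    have hC : 0 ≤ S.C₁ ^ 4 := by have := S.C₁_pos; positivity
    have b : ∀ v : H, ‖v‖ ≤ 2 * p → S.Q4 v v v v ≤ S.C₁ ^ 4 * (2 * p) ^ 4 := fun v hv =>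
      (S.embed_L4 v).trans (mul_le_mul_of_nonneg_left
        (pow_le_pow_left₀ (norm_nonneg v) hv 4) hC)
    have b1 := b (x + y) ((norm_add_le x y).trans (by linarith))
    have b2 := b (x - y) ((norm_sub_le x y).trans (by linarith))
    have : 0 ≤ S.C₁ ^ 4 * p ^ 4 := by positivity
    nlinarith [S.Q4_sq_nonneg x x, S.Q4_sq_nonneg y y]
  by_cases hz : ‖z‖ = 0
  · rw [norm_eq_zero.mp hz]; simp
  by_cases hw : ‖w‖ = 0
  · rw [norm_eq_zero.mp hw]; simp
  have h := key (‖w‖ • z) (‖z‖ • w) (‖z‖ * ‖w‖) (by rw [norm_smul, norm_norm, mul_comm])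
    (by rw [norm_smul, norm_norm])
  simp only [map_smul, LinearMap.smul_apply, smul_eq_mul] at h
  have hp : 0 < (‖z‖ * ‖w‖) ^ 2 := by positivity
  refine le_of_mul_le_mul_left ?_ hp
  linarith

theorem abs_Q4_diag_le (u z w : H) :
    |S.Q4 u u z w| ≤ 3 * S.C₁ ^ 4 * ‖u‖ ^ 2 * ‖z‖ * ‖w‖ := by
  have := S.C₁_pos
  refine abs_le_of_sq_le_sq ?_ (by positivity)
  calc S.Q4 u u z w ^ 2 ≤ S.Q4 u u z z * S.Q4 u u w w :=
        sq_apply_le_of_nonneg (S.Q4 u u) (S.Q4_symm₃ u u) (S.Q4_sq_nonneg u) z w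
    _ ≤ (3 * S.C₁ ^ 4 * ‖u‖ ^ 2 * ‖z‖ ^ 2) * (3 * S.C₁ ^ 4 * ‖u‖ ^ 2 * ‖w‖ ^ 2) :=
      mul_le_mul (S.Q4_sq_le u z) (S.Q4_sq_le u w) (S.Q4_sq_nonneg u w) (by positivity)
    _ = _ := by ring

theorem abs_Q4_le (a b c d : H) :
    |S.Q4 a b c d| ≤ 6 * S.C₁ ^ 4 * ‖a‖ * ‖b‖ * ‖c‖ * ‖d‖ := by
  have key : ∀ x y : H, ∀ p : ℝ, ‖x‖ ≤ p → ‖y‖ ≤ p →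
      |S.Q4 x y c d| ≤ 6 * S.C₁ ^ 4 * p ^ 2 * ‖c‖ * ‖d‖ := by
    intro x y p hx hy
    have e : S.Q4 (x + y) (x + y) c d - S.Q4 (x - y) (x - y) c d = 4 * S.Q4 x y c d := by
      simp only [map_add, map_sub, Q4_sub_apply, LinearMap.add_apply, LinearMap.sub_apply]
      rw [S.Q4_symm₁ y x]
      ring
    have hp : 0 ≤ p := (norm_nonneg x).trans hx
    have b : ∀ v : H, ‖v‖ ≤ 2 * p →
        |S.Q4 v v c d| ≤ 3 * S.C₁ ^ 4 * (2 * p) ^ 2 * ‖c‖ * ‖d‖ := fun v hv => by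
      have := S.C₁_pos
      refine (S.abs_Q4_diag_le v c d).trans ?_
      gcongr
    have b1 := abs_le.mp (b (x + y) ((norm_add_le x y).trans (by linarith)))
    have b2 := abs_le.mp (b (x - y) ((norm_sub_le x y).trans (by linarith)))
    rw [abs_le]
    constructor <;> linarith
  by_cases ha : ‖a‖ = 0
  · rw [norm_eq_zero.mp ha]; simp
  by_cases hb : ‖b‖ = 0
  · rw [norm_eq_zero.mp hb]; simp
  have h := key (‖b‖ • a) (‖a‖ • b) (‖a‖ * ‖b‖) (by rw [norm_smul, norm_norm, mul_comm])
    (by rw [norm_smul, norm_norm])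
  have hp : 0 < ‖a‖ * ‖b‖ := by positivity
  simp only [map_smul, LinearMap.smul_apply, smul_eq_mul] at h
  rw [← mul_assoc, abs_mul, abs_of_pos hp] at h
  refine le_of_mul_le_mul_left ?_ hp
  linarith

theorem norm_G0_le (u : H) : ‖S.G0 u‖ ≤ S.C₃ ^ 2 * ‖u‖ := by
  have h1 := S.sq_norm_le_a0form (S.G0 u)
  rw [a0form_apply, S.G0_def] at h1
  have h2 := (abs_le.mp (S.abs_P_le (S.G0 u) u)).2
  by_contra! h
  have h0 : 0 < ‖S.G0 u‖ := lt_of_le_of_lt (by positivity) h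
  nlinarith

theorem norm_G0c_sub_le (u v : H) : ‖S.G0c u - S.G0c v‖ ≤
    6 * S.C₁ ^ 4 * (‖u‖ ^ 2 + ‖u‖ * ‖v‖ + ‖v‖ ^ 2) * ‖u - v‖ := by
  set D := S.G0c u - S.G0c v with hD
  have h1 := S.sq_norm_le_a0form D
  have h2 : S.a0form D D = S.Q4 D u u u - S.Q4 D v v v := by
    conv_lhs => rw [hD, map_sub (S.a0form D)]
    rw [a0form_apply, a0form_apply, S.G0c_def, S.G0c_def]
  have h3 : S.Q4 D u u u - S.Q4 D v v v =
      S.Q4 D (u - v) u u + S.Q4 D v (u - v) u + S.Q4 D v v (u - v) := by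
    simp only [map_sub, LinearMap.sub_apply]; ring
  have b1 := (abs_le.mp (S.abs_Q4_le D (u - v) u u)).2
  have b2 := (abs_le.mp (S.abs_Q4_le D v (u - v) u)).2
  have b3 := (abs_le.mp (S.abs_Q4_le D v v (u - v))).2
  by_contra! h
  have h0 : 0 < ‖D‖ := lt_of_le_of_lt (by have := S.C₁_pos; positivity) h
  nlinarith

/-- The Lagrange multiplier in the Riemannian `a₀`-gradient. -/
noncomputable def mult (u : H) : ℝ := S.P (S.gradA0 u) u / S.P (S.G0 u) u

theorem gradRA0_eq (u : H) : S.gradRA0 u = S.gradA0 u - S.mult u • S.G0 u := by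
  have : S.a0norm (S.G0 u) ^ 2 = S.P (S.G0 u) u := by
    have h := S.a0form_nonneg (S.G0 u)
    rw [a0form_apply] at h
    rw [a0norm, a0inner, Real.sq_sqrt h, S.G0_def]
  rw [gradRA0, mult, this]

theorem one_le_a0form_mul {u : H} (hu : u ∈ S.Msphere) :
    1 ≤ S.a0form u u * S.P (S.G0 u) u := by
  have h := sq_apply_le_of_nonneg S.a0form S.a0form_symm S.a0form_nonneg u (S.G0 u)
  have h1 : S.a0form u (S.G0 u) = 1 := by rw [a0form_apply, S.G0_def]; exact hu
  have h2 : S.a0form (S.G0 u) (S.G0 u) = S.P (S.G0 u) u := by rw [a0form_apply, S.G0_def]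
  rw [h1, h2] at h
  simpa using h

theorem P_G0_pos {u : H} (hu : u ∈ S.Msphere) : 0 < S.P (S.G0 u) u := by
  have h := S.one_le_a0form_mul hu
  have := S.a0form_nonneg u
  by_contra! hn
  nlinarith

theorem P_gradRA0 {u : H} (hu : u ∈ S.Msphere) : S.P (S.gradRA0 u) u = 0 := by
  rw [gradRA0_eq, mult, map_sub, LinearMap.sub_apply, map_smul, LinearMap.smul_apply,
    smul_eq_mul, div_mul_cancel₀ _ (S.P_G0_pos hu).ne', sub_self]

theorem a0form_gradA0 (z u : H) :
    S.a0form z (S.gradA0 u) = S.a0form z u + S.β * S.Q4 z u u u := by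
  rw [gradA0, map_add, map_smul, smul_eq_mul, S.a0form_apply z (S.G0c u), S.G0c_def]

theorem a0form_gradRA0 (z u : H) :
    S.a0form z (S.gradRA0 u) = S.a0form z u + S.β * S.Q4 z u u u - S.mult u * S.P z u := by
  rw [gradRA0_eq, map_sub, a0form_gradA0, map_smul, smul_eq_mul, S.a0form_apply z (S.G0 u),
    S.G0_def]

theorem a0form_of_eigen {ustar : H} {lam0 : ℝ}
    (heig : ∀ z : H, S.auinner ustar z ustar = lam0 * S.P z ustar) (z : H) :
    S.a0form z ustar + S.β * S.Q4 z ustar ustar ustar = lam0 * S.P z ustar := by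
  rw [← heig, auinner, a0form_apply, S.Q4_symm₂ ustar ustar z, S.Q4_symm₁ ustar z]

theorem gradA0_of_eigen {ustar : H} {lam0 : ℝ}
    (heig : ∀ z : H, S.auinner ustar z ustar = lam0 * S.P z ustar) :
    S.gradA0 ustar = lam0 • S.G0 ustar := by
  refine S.eq_of_a0form_eq fun z => ?_
  rw [a0form_gradA0, S.a0form_of_eigen heig, map_smul, smul_eq_mul, S.a0form_apply z (S.G0 ustar),
    S.G0_def]

theorem exists_gradRA0_lipschitz {ustar : H} {lam0 : ℝ}
    (heig : ∀ z : H, S.auinner ustar z ustar = lam0 * S.P z ustar) :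
    ∃ L : ℝ, 0 < L ∧ ∀ u ∈ S.Msphere, ‖u - ustar‖ ≤ 1 →
      |S.mult u - lam0| ≤ L * ‖u - ustar‖ ∧ ‖S.gradRA0 u‖ ≤ L * ‖u - ustar‖ := by
  have hβ := S.β_nonneg
  have hC₁ := S.C₁_pos
  have hV := S.Vmax_nonneg
  set R := ‖ustar‖ + 1 with hR
  have hR0 : 0 < R := by positivity
  set K := 1 + S.β * (18 * S.C₁ ^ 4 * R ^ 2) + |lam0| * S.C₃ ^ 2 with hK
  have hK0 : 0 < K := by positivity
  set K' := S.C₃ ^ 2 * K * R * ((1 + S.Vmax * S.C₃ ^ 2) * R ^ 2) with hK'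
  have hK'0 : 0 ≤ K' := by positivity
  have hKC : 0 ≤ K' * (S.C₃ ^ 2 * R) := by positivity
  refine ⟨K + K' + K' * (S.C₃ ^ 2 * R), by positivity, fun u hu he => ?_⟩
  have hun : ‖u‖ ≤ R := by
    calc ‖u‖ = ‖ustar + (u - ustar)‖ := by rw [add_sub_cancel]
      _ ≤ R := (norm_add_le _ _).trans (by linarith)
  have hsn : ‖ustar‖ ≤ R := by linarith
  set e := u - ustar with hedef
  have hen : 0 ≤ ‖e‖ := norm_nonneg e
  set h := S.gradA0 u - lam0 • S.G0 u with hh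
  have hh2 : h = e + S.β • (S.G0c u - S.G0c ustar) - lam0 • S.G0 e := by
    have h0 := S.gradA0_of_eigen heig
    rw [gradA0] at h0
    have : h = h - (ustar + S.β • S.G0c ustar - lam0 • S.G0 ustar) := by
      rw [h0, sub_self, sub_zero]
    rw [this, hh, gradA0, hedef, map_sub]
    module
  have hhn : ‖h‖ ≤ K * ‖e‖ := by
    have b1 : ‖S.β • (S.G0c u - S.G0c ustar)‖ ≤ S.β * (18 * S.C₁ ^ 4 * R ^ 2 * ‖e‖) := by
      rw [norm_smul, Real.norm_of_nonneg hβ]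
      refine mul_le_mul_of_nonneg_left ((S.norm_G0c_sub_le u ustar).trans ?_) hβ
      calc _ ≤ 6 * S.C₁ ^ 4 * (R ^ 2 + R * R + R ^ 2) * ‖e‖ := by gcongr
        _ = _ := by ring
    have b2 : ‖lam0 • S.G0 e‖ ≤ |lam0| * (S.C₃ ^ 2 * ‖e‖) := by
      rw [norm_smul, Real.norm_eq_abs]
      exact mul_le_mul_of_nonneg_left (S.norm_G0_le e) (abs_nonneg _)
    have b3 := norm_sub_le (e + S.β • (S.G0c u - S.G0c ustar)) (lam0 • S.G0 e)
    have b4 := norm_add_le e (S.β • (S.G0c u - S.G0c ustar))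
    rw [hh2, hK]
    linarith
  have hp := S.P_G0_pos hu
  have hm : S.mult u - lam0 = S.P h u / S.P (S.G0 u) u := by
    rw [mult, hh, map_sub, LinearMap.sub_apply, map_smul, LinearMap.smul_apply, smul_eq_mul]
    field_simp
  have hmn : |S.mult u - lam0| ≤ K' * ‖e‖ := by
    have b1 : 1 ≤ ((1 + S.Vmax * S.C₃ ^ 2) * R ^ 2) * S.P (S.G0 u) u := by
      refine (S.one_le_a0form_mul hu).trans (mul_le_mul_of_nonneg_right ?_ hp.le)
      exact (S.a0form_le u).trans (by gcongr)
    have b2 : |S.P h u| ≤ S.C₃ ^ 2 * K * R * ‖e‖ := by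
      calc |S.P h u| ≤ S.C₃ ^ 2 * ‖h‖ * ‖u‖ := S.abs_P_le h u
        _ ≤ S.C₃ ^ 2 * (K * ‖e‖) * R := by gcongr
        _ = _ := by ring
    rw [hm, abs_div, abs_of_pos hp, div_le_iff₀ hp, hK']
    have b3 : 0 ≤ S.C₃ ^ 2 * K * R * ‖e‖ := by positivity
    linarith [mul_le_mul_of_nonneg_left b1 b3]
  have hKe := mul_nonneg hK0.le hen
  have hK'e := mul_nonneg hK'0 hen
  have hKCe := mul_nonneg hKC hen
  constructor
  · linarith
  · have hg : S.gradRA0 u = h - (S.mult u - lam0) • S.G0 u := by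
      rw [gradRA0_eq, hh]
      module
    have b1 : ‖(S.mult u - lam0) • S.G0 u‖ ≤ (K' * ‖e‖) * (S.C₃ ^ 2 * R) := by
      rw [norm_smul, Real.norm_eq_abs]
      refine mul_le_mul hmn ((S.norm_G0_le u).trans (by gcongr)) (norm_nonneg _) (by positivity)
    have b2 := norm_sub_le h ((S.mult u - lam0) • S.G0 u)
    rw [hg]
    linarith

theorem auinner_sub_ge {ustar : H} {lam0 lam1 : ℝ} (hs : ustar ∈ S.Msphere)
    (heig : S.LinearizedEigs ustar lam0 lam1) (hlam0 : 0 < lam0) (hgap : lam0 < lam1) (e : H) :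
    (1 - lam0 / lam1) * (S.auinner ustar e e - lam0 * S.P e ustar ^ 2) ≤
      S.auinner ustar e e - lam0 * S.P e e := by
  obtain ⟨h1, -, h3⟩ := heig
  have hs' : S.P ustar ustar = 1 := hs
  set t := S.P e ustar with ht
  set w := e - t • ustar with hw
  have hwP : S.P w ustar = 0 := by
    rw [hw, map_sub, LinearMap.sub_apply, map_smul, LinearMap.smul_apply, hs', smul_eq_mul,
      mul_one, ← ht, sub_self]
  have hPw : S.P w w = S.P e e - t ^ 2 := by
    rw [hw]
    simp only [map_sub, map_smul, LinearMap.sub_apply, LinearMap.smul_apply, smul_eq_mul, hs']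
    rw [S.P_symm ustar e, ← ht]
    ring
  have haw : S.auinner ustar w w = S.auinner ustar e e - lam0 * t ^ 2 := by
    have a1 := h1 e
    have a2 := h1 ustar
    rw [hs'] at a2
    rw [← ht] at a1
    rw [auinner] at a1 a2
    rw [auinner, auinner, hw]
    simp only [map_sub, map_smul, LinearMap.sub_apply, LinearMap.smul_apply, smul_eq_mul,
      inner_sub_left, inner_sub_right, real_inner_smul_left, real_inner_smul_right]
    rw [S.Vf_symm ustar e, S.Q4_symm₃ ustar ustar ustar e, real_inner_comm e ustar]
    linear_combination (-2 * t) * a1 + t ^ 2 * a2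
  have h := h3 w hwP
  rw [haw, hPw] at h
  have hlam1 : 0 < lam1 := hlam0.trans hgap
  have : lam0 * (S.P e e - t ^ 2) ≤ lam0 / lam1 * (S.auinner ustar e e - lam0 * t ^ 2) := by
    rw [div_mul_eq_mul_div, le_div_iff₀ hlam1]
    nlinarith
  linarith

theorem exists_gradRA0_strongly_monotone {ustar : H} {lam0 lam1 : ℝ} (hs : ustar ∈ S.Msphere)
    (heig : S.LinearizedEigs ustar lam0 lam1) (hlam0 : 0 < lam0) (hgap : lam0 < lam1) :
    ∃ c δ : ℝ, 0 < c ∧ 0 < δ ∧ δ ≤ 1 ∧ ∀ u ∈ S.Msphere, ‖u - ustar‖ ≤ δ →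
      c * ‖u - ustar‖ ^ 2 ≤ S.a0form (u - ustar) (S.gradRA0 u) := by
  obtain ⟨L, hL, hLip⟩ := S.exists_gradRA0_lipschitz heig.1
  have hlam1 : 0 < lam1 := hlam0.trans hgap
  have hβ := S.β_nonneg
  have hC₁ := S.C₁_pos
  set c := 1 - lam0 / lam1 with hc
  have hc0 : 0 < c := by rw [hc, sub_pos, div_lt_one hlam1]; exact hgap
  set A := c * lam0 * (S.C₃ ^ 4 / 4) + S.β * (18 * S.C₁ ^ 4 * ‖ustar‖ + 6 * S.C₁ ^ 4) +
    L * S.C₃ ^ 2 / 2 + 1 with hA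
  have hA0 : 0 < A := by positivity
  refine ⟨c / 2, min 1 (c / (2 * A)), by positivity, by positivity, min_le_left _ _,
    fun u hu hδ => ?_⟩
  have hsP : S.P ustar ustar = 1 := hs
  have huP : S.P u u = 1 := hu
  have he1 : ‖u - ustar‖ ≤ 1 := hδ.trans (min_le_left _ _)
  have he2 : ‖u - ustar‖ * (2 * A) ≤ c := by
    rw [← le_div_iff₀ (by positivity)]; exact hδ.trans (min_le_right _ _)
  obtain ⟨hmult, -⟩ := hLip u hu he1
  set e := u - ustar with he
  have hue : u = ustar + e := by rw [he, add_sub_cancel]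
  have hn : 0 ≤ ‖e‖ := norm_nonneg e
  have hPe : S.P e ustar = -(1 / 2) * S.P e e := by
    have : S.P (ustar + e) (ustar + e) = 1 := by rw [← hue]; exact huP
    simp only [map_add, LinearMap.add_apply, hsP, S.P_symm ustar e] at this
    linarith
  have hPu : S.P e u = (1 / 2) * S.P e e := by
    rw [hue, map_add, hPe]; ring
  have hQ : S.Q4 e u u u = S.Q4 e ustar ustar ustar + 3 * S.Q4 ustar ustar e e +
      3 * S.Q4 ustar e e e + S.Q4 e e e e := by
    rw [hue]
    simp only [map_add, LinearMap.add_apply]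
    have q1 : S.Q4 e ustar ustar e = S.Q4 ustar ustar e e := by
      rw [S.Q4_symm₁, S.Q4_symm₂]
    have q2 : S.Q4 e ustar e ustar = S.Q4 ustar ustar e e := by rw [S.Q4_symm₃, q1]
    have q3 : S.Q4 e e ustar ustar = S.Q4 ustar ustar e e := by rw [S.Q4_symm₂, q2]
    have q4 : S.Q4 e ustar e e = S.Q4 ustar e e e := S.Q4_symm₁ _ _ _ _
    have q5 : S.Q4 e e ustar e = S.Q4 ustar e e e := by rw [S.Q4_symm₂, q4]
    have q6 : S.Q4 e e e ustar = S.Q4 ustar e e e := by rw [S.Q4_symm₃, q5]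
    rw [q1, q2, q3, q4, q5, q6]
    ring
  have hau : S.auinner ustar e e = S.a0form e e + S.β * S.Q4 ustar ustar e e := rfl
  have hmain : S.a0form e (S.gradRA0 u) = S.auinner ustar e e - lam0 * S.P e e +
      2 * (S.β * S.Q4 ustar ustar e e) + S.β * (3 * S.Q4 ustar e e e + S.Q4 e e e e) -
      (1 / 2) * ((S.mult u - lam0) * S.P e e) := by
    have h1 := S.a0form_of_eigen heig.1 e
    have h2 : S.a0form e u = S.a0form e ustar + S.a0form e e := by
      conv_lhs => rw [hue, map_add]
    rw [a0form_gradRA0, hQ, hPu, h2, hau]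
    rw [hPe] at h1
    linear_combination h1
  have b1 := S.auinner_sub_ge hs heig hlam0 hgap e
  have hPn := (abs_le.mp (S.abs_P_le e e)).2
  have hP0 := S.P_nonneg e
  have b2 : S.P e ustar ^ 2 ≤ S.C₃ ^ 4 / 4 * ‖e‖ ^ 3 := by
    have h4 : S.P e e ^ 2 ≤ (S.C₃ ^ 2 * ‖e‖ * ‖e‖) ^ 2 := pow_le_pow_left₀ hP0 hPn 2
    have h5 : ‖e‖ ^ 4 ≤ ‖e‖ ^ 3 := pow_le_pow_of_le_one hn he1 (by norm_num)
    have h6 : 0 ≤ S.C₃ ^ 4 := by positivity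
    rw [hPe]
    linarith [mul_le_mul_of_nonneg_left h5 h6]
  have b3 : ‖e‖ ^ 2 ≤ S.auinner ustar e e := by
    rw [hau]
    have := mul_nonneg hβ (S.Q4_sq_nonneg ustar e)
    linarith [S.sq_norm_le_a0form e]
  have b4 : -(18 * S.C₁ ^ 4 * ‖ustar‖ + 6 * S.C₁ ^ 4) * ‖e‖ ^ 3 ≤
      3 * S.Q4 ustar e e e + S.Q4 e e e e := by
    have h1 := (abs_le.mp (S.abs_Q4_le ustar e e e)).1
    have h2 := S.Q4_sq_nonneg e e
    have h3 : 0 ≤ 6 * S.C₁ ^ 4 * ‖e‖ ^ 3 := by positivity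
    linarith
  have b5 : (S.mult u - lam0) * S.P e e ≤ L * S.C₃ ^ 2 * ‖e‖ ^ 3 := by
    calc (S.mult u - lam0) * S.P e e ≤ (L * ‖e‖) * (S.C₃ ^ 2 * ‖e‖ * ‖e‖) :=
          mul_le_mul ((le_abs_self _).trans hmult) hPn hP0 (by positivity)
      _ = _ := by ring
  have b6 := mul_le_mul_of_nonneg_left b4 hβ
  have b7 := mul_nonneg hβ (S.Q4_sq_nonneg ustar e)
  have b8 : c * (‖e‖ ^ 2 - lam0 * (S.C₃ ^ 4 / 4 * ‖e‖ ^ 3)) ≤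
      c * (S.auinner ustar e e - lam0 * S.P e ustar ^ 2) := by gcongr
  have b9 : A * ‖e‖ ^ 3 ≤ c / 2 * ‖e‖ ^ 2 := by
    linarith [mul_le_mul_of_nonneg_right he2 (sq_nonneg ‖e‖)]
  have b10 : 0 ≤ ‖e‖ ^ 3 := by positivity
  rw [hmain]
  rw [hA] at b9
  linarith

theorem one_sub_inv_le_sq_sub_one {l : ℝ} (hl : 1 ≤ l) : 1 - l⁻¹ ≤ l ^ 2 - 1 := by
  have h : l⁻¹ * l = 1 := inv_mul_cancel₀ (by linarith)
  have h1 : l⁻¹ ≤ 1 := inv_le_one_of_one_le₀ hl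
  nlinarith

theorem exists_step_contraction {ustar : H} {lam0 lam1 : ℝ} (hs : ustar ∈ S.Msphere)
    (heig : S.LinearizedEigs ustar lam0 lam1) (hlam0 : 0 < lam0) (hgap : lam0 < lam1) :
    ∃ c A δ : ℝ, 0 < c ∧ 0 < A ∧ A ≤ 1 ∧ A * c ≤ 1 / 2 ∧ 0 < δ ∧
      ∀ u ∈ S.Msphere, ‖u - ustar‖ ≤ δ → ∀ α : ℝ, 0 < α → α ≤ A →
        S.retract (u - α • S.gradRA0 u) ∈ S.Msphere ∧
        S.a0form (S.retract (u - α • S.gradRA0 u) - ustar)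
            (S.retract (u - α • S.gradRA0 u) - ustar) ≤
          (1 - α * c) * S.a0form (u - ustar) (u - ustar) := by
  obtain ⟨L, hL, hLip⟩ := S.exists_gradRA0_lipschitz heig.1
  obtain ⟨c₀, δ, hc₀, hδ, hδ1, hmono⟩ := S.exists_gradRA0_strongly_monotone hs heig hlam0 hgap
  have hV := S.Vmax_nonneg
  set m := 1 + S.Vmax * S.C₃ ^ 2 with hm
  have hm0 : 0 < m := by positivity
  set c := c₀ / m with hc
  have hc0 : 0 < c := by positivity
  set T := ‖ustar‖ + 1 + L with hT
  have hT0 : 0 < T := by positivity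
  set X := m * L ^ 2 + S.C₃ ^ 2 * L ^ 2 * (3 * (m * T ^ 2)) with hX
  have hX0 : 0 < X := by positivity
  set Y := X + 2 * c ^ 2 + c + 1 with hY
  have hY0 : 0 < Y := by positivity
  have hA1 : c / Y ≤ 1 := by
    rw [div_le_one hY0, hY]
    linarith [sq_nonneg c]
  have hAc : c / Y * c ≤ 1 / 2 := by
    rw [div_mul_eq_mul_div, div_le_iff₀ hY0, hY]
    linarith
  have hAX : c / Y * X ≤ c := by
    rw [div_mul_eq_mul_div, div_le_iff₀ hY0]
    exact mul_le_mul_of_nonneg_left (by rw [hY]; linarith [sq_nonneg c]) hc0.le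
  refine ⟨c, c / Y, δ, hc0, by positivity, hA1, hAc, hδ, fun u hu he α hα hαA => ?_⟩
  have he1 := he.trans hδ1
  have hm1 := hmono u hu he
  obtain ⟨-, hg⟩ := hLip u hu he1
  have hPg := S.P_gradRA0 hu
  have huP : S.P u u = 1 := hu
  have hα1 : α ≤ 1 := hαA.trans hA1
  set e := u - ustar with hedef
  set g := S.gradRA0 u
  set v := u - α • g with hv
  have hNe := S.sq_norm_le_a0form e
  have hNe0 := S.a0form_nonneg e
  set N := S.a0form e e
  have hgN : ‖g‖ ^ 2 ≤ L ^ 2 * N := by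
    calc ‖g‖ ^ 2 ≤ (L * ‖e‖) ^ 2 := pow_le_pow_left₀ (norm_nonneg g) hg 2
      _ = L ^ 2 * ‖e‖ ^ 2 := by ring
      _ ≤ L ^ 2 * N := by gcongr
  have hcN : c * N ≤ S.a0form e g := by
    refine le_trans ?_ hm1
    rw [hc, div_mul_eq_mul_div, div_le_iff₀ hm0, mul_assoc]
    refine mul_le_mul_of_nonneg_left ?_ hc₀.le
    rw [mul_comm]
    exact S.a0form_le e
  set d := v - ustar with hd
  have hde : d = e - α • g := by rw [hd, hv, hedef]; abel
  have hNd : S.a0form d d ≤ N - 2 * α * (c * N) + α ^ 2 * (m * (L ^ 2 * N)) := by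
    have h1 : S.a0form d d = N - 2 * α * S.a0form e g + α ^ 2 * S.a0form g g := by
      rw [hde]
      simp only [map_sub, map_smul, LinearMap.sub_apply, LinearMap.smul_apply, smul_eq_mul]
      rw [S.a0form_symm g e]
      ring
    have h2 : S.a0form g g ≤ m * (L ^ 2 * N) :=
      (S.a0form_le g).trans (mul_le_mul_of_nonneg_left hgN hm0.le)
    rw [h1]
    gcongr
  have hPv : S.P v v = 1 + α ^ 2 * S.P g g := by
    rw [hv]
    simp only [map_sub, map_smul, LinearMap.sub_apply, LinearMap.smul_apply, smul_eq_mul]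
    rw [S.P_symm u g, hPg, huP]
    ring
  have hPgg : S.P g g ≤ S.C₃ ^ 2 * (L ^ 2 * N) :=
    (S.poincare g).trans (mul_le_mul_of_nonneg_left hgN (sq_nonneg _))
  have hPgg0 := S.P_nonneg g
  have hPv1 : 1 ≤ S.P v v := by
    rw [hPv]
    linarith [mul_nonneg (sq_nonneg α) hPgg0]
  have hl1 : 1 ≤ S.l2norm v := Real.one_le_sqrt.mpr hPv1
  have hlsq : S.l2norm v ^ 2 = S.P v v := Real.sq_sqrt (S.P_nonneg v)
  have hl0 : 0 < S.l2norm v := by linarith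
  have hret : S.retract v = (S.l2norm v)⁻¹ • v := rfl
  set s := (S.l2norm v)⁻¹ with hsdef
  have hs0 : 0 < s := inv_pos.mpr hl0
  have hs1 : s ≤ 1 := inv_le_one_of_one_le₀ hl1
  have hsl : s * S.l2norm v = 1 := inv_mul_cancel₀ hl0.ne'
  have hs2 : 1 - s ≤ α ^ 2 * (S.C₃ ^ 2 * (L ^ 2 * N)) := by
    have h2 := one_sub_inv_le_sq_sub_one hl1
    rw [hlsq, hPv] at h2
    linarith [mul_le_mul_of_nonneg_left hPgg (sq_nonneg α)]
  have hαg : ‖α • g‖ ≤ L := by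
    rw [norm_smul, Real.norm_of_nonneg hα.le]
    calc α * ‖g‖ ≤ 1 * (L * 1) :=
          mul_le_mul hα1 (hg.trans (mul_le_mul_of_nonneg_left he1 hL.le)) (norm_nonneg g)
            zero_le_one
      _ = L := by ring
  have hdT : ‖d‖ ≤ 1 + L := by
    rw [hde]
    exact (norm_sub_le _ _).trans (add_le_add he1 hαg)
  have hvT : ‖v‖ ≤ T := by
    have h1 : v = ustar + d := by rw [hd, add_sub_cancel]
    have h2 := norm_add_le ustar d
    rw [← h1] at h2
    linarith
  have hdT' : ‖d‖ ≤ T := by linarith [norm_nonneg ustar]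
  have hNT : ∀ x : H, ‖x‖ ≤ T → S.a0form x x ≤ m * T ^ 2 := fun x hx =>
    (S.a0form_le x).trans (by gcongr)
  have hNv := hNT v hvT
  have hNd' := hNT d hdT'
  rw [hret]
  constructor
  · change S.P (s • v) (s • v) = 1
    simp only [map_smul, LinearMap.smul_apply, smul_eq_mul]
    rw [← hlsq]
    linear_combination (s * S.l2norm v + 1) * hsl
  · have h1 : s • v - ustar = d - (1 - s) • v := by
      rw [hd]; module
    have h2 : S.a0form (s • v - ustar) (s • v - ustar) =
        S.a0form d d - 2 * (1 - s) * S.a0form d v + (1 - s) ^ 2 * S.a0form v v := by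
      rw [h1]
      simp only [map_sub, map_smul, LinearMap.sub_apply, LinearMap.smul_apply, smul_eq_mul]
      rw [S.a0form_symm v d]
      ring
    have h3 : -(2 * S.a0form d v) ≤ S.a0form d d + S.a0form v v := by
      have h := S.a0form_nonneg (d + v)
      simp only [map_add, LinearMap.add_apply] at h
      rw [S.a0form_symm v d] at h
      linarith
    have hr0 : 0 ≤ 1 - s := by linarith
    have h4 : (1 - s) ^ 2 * S.a0form v v ≤ (1 - s) * S.a0form v v :=
      mul_le_mul_of_nonneg_right (pow_le_of_le_one hr0 (by linarith) two_ne_zero)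
        (S.a0form_nonneg v)
    have h5 : (1 - s) * (-(2 * S.a0form d v) + S.a0form v v) ≤
        α ^ 2 * (S.C₃ ^ 2 * (L ^ 2 * N)) * (3 * (m * T ^ 2)) :=
      (mul_le_mul_of_nonneg_left (by linarith) hr0).trans
        (mul_le_mul_of_nonneg_right hs2 (by positivity))
    have h6 : α ^ 2 * X * N ≤ α * c * N := by
      refine mul_le_mul_of_nonneg_right ?_ hNe0
      rw [sq, mul_assoc]
      exact mul_le_mul_of_nonneg_left
        ((mul_le_mul_of_nonneg_right hαA hX0.le).trans hAX) hα.le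
    rw [h2]
    rw [hX] at h6
    linarith

end GPSetting

/-- **Local exponential convergence for the `a₀`-scheme**
(Theorem `thm:local_conv_a0`).  Assume the hypotheses of the energy-decay
theorem for the `a₀`-scheme and the eigengap assumption `λ₁ > λ₀` for the
linearized problem at the ground state `u*`.  Then there are constants `Cα`
(the energy-decay stepsize threshold) and `Lg > 0` (depending only on
`Ω, d, β, V, u*` and `r = ‖u₀‖_{H¹₀}`) such that whenever the stepsizes satisfy
`0 < αmin ≤ αₙ ≤ αmax ≤ Cα` and
`1 + Lg²αmax² − αmax·min{1, (λ₁−λ₀)/(4λ₀)} < 1`, the `a₀`-scheme iterates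
starting from any `u₀ ∈ M` close enough to `u*` converge exponentially to `u*`
in `H¹₀(Ω)`. -/
theorem local_conv_a0
    {H : Type*} [NormedAddCommGroup H] [InnerProductSpace ℝ H]
    (S : GPSetting H) (ustar : H) (lam0 lam1 : ℝ)
    (hgs : S.IsGroundState ustar)
    (heig : S.LinearizedEigs ustar lam0 lam1)
    (hlam0 : 0 < lam0) (hgap : lam0 < lam1) (r : ℝ) :
    ∃ Cα Lg : ℝ, 0 < Cα ∧ Cα ≤ 1 ∧ 0 < Lg ∧
      ∃ δ : ℝ, 0 < δ ∧
        ∀ u₀ : H, u₀ ∈ S.Msphere → ‖u₀‖ = r → ‖u₀ - ustar‖ ≤ δ →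
          ∀ (αmin αmax : ℝ) (α : ℕ → ℝ),
            0 < αmin → (∀ n : ℕ, αmin ≤ α n ∧ α n ≤ αmax) → αmax ≤ Cα →
            1 + Lg ^ 2 * αmax ^ 2 - αmax * min 1 ((lam1 - lam0) / (4 * lam0)) < 1 →
            ∀ u : ℕ → H, u 0 = u₀ →
              (∀ n : ℕ, u (n + 1) = S.retract (u n - α n • S.gradRA0 (u n))) →
              ∃ C q : ℝ, 0 < C ∧ 0 < q ∧ q < 1 ∧
                ∀ n : ℕ, ‖u n - ustar‖ ≤ C * q ^ n := by
  obtain ⟨c, A, δ, hc, hA, hA1, hAc, hδ, hstep⟩ :=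
    S.exists_step_contraction hgs.1 heig hlam0 hgap
  have hm : 1 ≤ 1 + S.Vmax * S.C₃ ^ 2 := by
    have := S.Vmax_nonneg
    have : 0 ≤ S.Vmax * S.C₃ ^ 2 := by positivity
    linarith
  set m := 1 + S.Vmax * S.C₃ ^ 2
  have hm0 : 0 < m := by linarith
  refine ⟨A, 1, hA, hA1, one_pos, δ / m, by positivity, ?_⟩
  intro u₀ hu₀ _ hclose αmin αmax α hαmin hα hαmax _ u hu0 hu
  have hαA : ∀ n, 0 < α n ∧ α n ≤ A := fun n =>
    ⟨hαmin.trans_le (hα n).1, (hα n).2.trans hαmax⟩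
  set Q := 1 - αmin * c with hQ
  have hαc : αmin * c ≤ 1 / 2 :=
    (mul_le_mul_of_nonneg_right ((hα 0).1.trans (hαA 0).2) hc.le).trans hAc
  have hαc0 : 0 < αmin * c := by positivity
  have hQ0 : 0 < Q := by linarith
  have hQ1 : Q < 1 := by linarith
  set N₀ := S.a0form (u₀ - ustar) (u₀ - ustar) with hN₀
  have hN₀0 : 0 ≤ N₀ := S.a0form_nonneg _
  have hN₀δ : N₀ ≤ δ ^ 2 := by
    calc N₀ ≤ m * ‖u₀ - ustar‖ ^ 2 := S.a0form_le _
      _ ≤ m * (δ / m) ^ 2 := by gcongr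
      _ = δ ^ 2 / m := by field_simp
      _ ≤ δ ^ 2 := div_le_self (by positivity) hm
  have hinv : ∀ n, u n ∈ S.Msphere ∧ S.a0form (u n - ustar) (u n - ustar) ≤ Q ^ n * N₀ := by
    intro n
    induction n with
    | zero => rw [hu0, pow_zero, one_mul]; exact ⟨hu₀, le_rfl⟩
    | succ n ih =>
      obtain ⟨hM, hN⟩ := ih
      have hball : ‖u n - ustar‖ ≤ δ := by
        refine le_of_sq_le_sq ?_ hδ.le
        calc ‖u n - ustar‖ ^ 2 ≤ Q ^ n * N₀ := (S.sq_norm_le_a0form _).trans hN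
          _ ≤ 1 * N₀ := mul_le_mul_of_nonneg_right (pow_le_one₀ hQ0.le hQ1.le) hN₀0
          _ ≤ δ ^ 2 := by rw [one_mul]; exact hN₀δ
      obtain ⟨h1, h2⟩ := hstep (u n) hM hball (α n) (hαA n).1 (hαA n).2
      rw [hu n]
      refine ⟨h1, h2.trans ?_⟩
      calc (1 - α n * c) * S.a0form (u n - ustar) (u n - ustar)
          ≤ Q * S.a0form (u n - ustar) (u n - ustar) := by
            refine mul_le_mul_of_nonneg_right ?_ (S.a0form_nonneg _)
            linarith [mul_le_mul_of_nonneg_right (hα n).1 hc.le]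
        _ ≤ Q * (Q ^ n * N₀) := mul_le_mul_of_nonneg_left hN hQ0.le
        _ = Q ^ (n + 1) * N₀ := by ring
  refine ⟨√N₀ + 1, √Q, by positivity, Real.sqrt_pos.mpr hQ0, ?_, fun n => ?_⟩
  · rw [Real.sqrt_lt' one_pos, one_pow]; exact hQ1
  · have hq : 0 ≤ √Q ^ n := by positivity
    have h : ‖u n - ustar‖ ≤ √N₀ * √Q ^ n := by
      refine le_of_sq_le_sq ((S.sq_norm_le_a0form _).trans ((hinv n).2.trans_eq ?_))
        (by positivity)
      rw [mul_pow, Real.sq_sqrt hN₀0, ← pow_mul, mul_comm n 2, pow_mul, Real.sq_sqrt hQ0.le,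
        mul_comm]
    linarith
end

section
/- For every u ∈ M and every ξ ∈ T_uM, the retraction R(u) = u/‖u‖_{L²(Ω)} satisfies ‖R(u+ξ) − (u+ξ)‖_{H^1_0(Ω)} ≤ (1/2)‖ξ‖²_{L²(Ω)}·‖u+ξ‖_{H^1_0(Ω)}. -/
open scoped RealInnerProductSpace
open Filter Topology

/-- **Retraction estimate** (Lemma `lem:esti_retraction`).
For every `u ∈ M` and every `ξ ∈ T_uM` (i.e. `(u,ξ)_{L²} = 0`),
`‖R(u+ξ) − (u+ξ)‖_{H¹₀} ≤ (1/2)‖ξ‖²_{L²}‖u+ξ‖_{H¹₀}`. -/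
theorem retraction_estimate
    {H : Type*} [NormedAddCommGroup H] [InnerProductSpace ℝ H]
    (S : GPSetting H) (u ξ : H) (hu : u ∈ S.Msphere) (hξ : S.P u ξ = 0) :
    ‖S.retract (u + ξ) - (u + ξ)‖ ≤ 1 / 2 * (S.l2norm ξ) ^ 2 * ‖u + ξ‖ := by
  have hPu : S.P u u = 1 := hu
  have hsum : S.P (u + ξ) (u + ξ) = 1 + S.P ξ ξ := by
    simp only [map_add, LinearMap.add_apply, hPu, hξ, S.P_symm ξ u]
    ring
  have hξ_nonneg := S.P_nonneg ξ
  have hsq : S.l2norm (u + ξ) ^ 2 = 1 + S.P ξ ξ := by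
    rw [GPSetting.l2norm, Real.sq_sqrt (S.P_nonneg _), hsum]
  have hξ_sq : S.l2norm ξ ^ 2 = S.P ξ ξ := Real.sq_sqrt hξ_nonneg
  have hone : 1 ≤ S.l2norm (u + ξ) := by
    rw [GPSetting.l2norm, Real.one_le_sqrt, hsum]
    linarith
  have hdiff : S.retract (u + ξ) - (u + ξ) = ((S.l2norm (u + ξ))⁻¹ - 1) • (u + ξ) := by
    rw [sub_smul, one_smul, GPSetting.retract]
  rw [hdiff, norm_smul, hξ_sq]
  gcongr
  have hinv : (S.l2norm (u + ξ))⁻¹ ≤ 1 := inv_le_one_of_one_le₀ hone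
  have hmul : (S.l2norm (u + ξ))⁻¹ * S.l2norm (u + ξ) = 1 :=
    inv_mul_cancel₀ (zero_lt_one.trans_le hone).ne'
  rw [Real.norm_eq_abs, abs_of_nonpos (by linarith)]
  nlinarith [sq_nonneg (S.l2norm (u + ξ) - 1), mul_nonneg (sub_nonneg.2 hinv) (sub_nonneg.2 hone)]
end
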